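/- arXiv:2510.14290 — 2 statements merged into one kernel-verified Lean document; each statement's English description precedes it below -/
import Mathlib

section
/- For every real number x ≥ 0, the Gaussian tail function admits Craig's representation: Q(x) = (1/π) ∫_0^{π/2} exp(−x²/(2 sin²θ)) dθ, where Q(x) = ∫_x^∞ (1/√(2π)) e^{−t²/2} dt. -/
open MeasureTheory

/-- The Gaussian tail function Q(x) = ∫_x^∞ (1/√(2π)) e^{−t²/2} dt. -/
noncomputable def gaussQ (x : ℝ) : ℝ :=
  ∫ t in Set.Ioi x, (1 / Real.sqrt (2 * Real.pi)) * Real.exp (-t ^ 2 / 2)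

/-- The Gaussian kernel, restricted to the half-line `(a, ∞)`. -/
noncomputable def gaussTail (a : ℝ) : ℝ → ℝ :=
  (Set.Ioi a).indicator fun t => Real.exp (-t ^ 2 / 2)

lemma measurable_gaussTail (a : ℝ) : Measurable (gaussTail a) :=
  Measurable.indicator (by fun_prop) measurableSet_Ioi

lemma gaussTail_of_lt {a t : ℝ} (h : a < t) : gaussTail a t = Real.exp (-t ^ 2 / 2) :=
  Set.indicator_of_mem (Set.mem_Ioi.2 h) _

lemma gaussTail_of_le {a t : ℝ} (h : t ≤ a) : gaussTail a t = 0 :=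
  Set.indicator_of_notMem (by simpa using h) _

lemma gaussTail_nonneg (a t : ℝ) : 0 ≤ gaussTail a t :=
  Set.indicator_nonneg (fun _ _ => (Real.exp_pos _).le) _

lemma gaussTail_le (a t : ℝ) : gaussTail a t ≤ Real.exp (-t ^ 2 / 2) :=
  Set.indicator_le_self' (fun _ _ => (Real.exp_pos _).le) _

lemma integral_gaussTail (a : ℝ) :
    ∫ t, gaussTail a t = ∫ t in Set.Ioi a, Real.exp (-t ^ 2 / 2) :=
  integral_indicator measurableSet_Ioi

lemma integral_gaussTail_zero : ∫ t, gaussTail 0 t = Real.sqrt (2 * Real.pi) / 2 := by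
  rw [integral_gaussTail]
  have h := integral_gaussian_Ioi (1 / 2)
  rw [show Real.pi / (1 / 2) = 2 * Real.pi by ring] at h
  rw [← h]
  congr 1 with t
  ring_nf

lemma exp_neg_sq_mul_cos_mul_exp_neg_sq_mul_sin (r θ : ℝ) :
    Real.exp (-(r * Real.cos θ) ^ 2 / 2) * Real.exp (-(r * Real.sin θ) ^ 2 / 2) =
      Real.exp (-r ^ 2 / 2) := by
  rw [← Real.exp_add]
  congr 1
  linear_combination (-r ^ 2 / 2) * Real.sin_sq_add_cos_sq θ

lemma integrableOn_mul_exp_neg_sq_and_integral_eq {a : ℝ} (ha : 0 ≤ a) :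
    IntegrableOn (fun r : ℝ => r * Real.exp (-r ^ 2 / 2)) (Set.Ioi a) ∧
      ∫ r in Set.Ioi a, r * Real.exp (-r ^ 2 / 2) = Real.exp (-a ^ 2 / 2) := by
  have hderiv : ∀ r ∈ Set.Ici a, HasDerivAt (fun r : ℝ => -Real.exp (-r ^ 2 / 2))
      (r * Real.exp (-r ^ 2 / 2)) r := by
    intro r _
    have h := ((((hasDerivAt_id r).pow 2).neg.div_const 2).exp).neg
    refine h.congr_deriv ?_
    simp
    ring
  have hnonneg : ∀ r ∈ Set.Ioi a, 0 ≤ r * Real.exp (-r ^ 2 / 2) := fun r hr =>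
    mul_nonneg (ha.trans (le_of_lt hr)) (Real.exp_pos _).le
  have hlim : Filter.Tendsto (fun r : ℝ => -Real.exp (-r ^ 2 / 2)) Filter.atTop (nhds 0) := by
    rw [← neg_zero]
    refine (Real.tendsto_exp_atBot.comp ?_).neg
    have h := (Filter.tendsto_neg_atTop_atBot.comp
      (Filter.tendsto_pow_atTop (α := ℝ) two_ne_zero)).atBot_div_const (zero_lt_two (α := ℝ))
    exact h
  refine ⟨integrableOn_Ioi_deriv_of_nonneg' hderiv hnonneg hlim, ?_⟩
  rw [integral_Ioi_of_hasDerivAt_of_nonneg' hderiv hnonneg hlim]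
  ring

/-- The radial part of the polar-coordinate integral over the quadrant `(x, ∞) × (0, ∞)`. -/
lemma integral_radial_gaussTail {x : ℝ} (hx : 0 ≤ x) {θ : ℝ}
    (hθ : θ ∈ Set.Ioo (-Real.pi) Real.pi) :
    ∫ r in Set.Ioi (0 : ℝ), r * (gaussTail x (r * Real.cos θ) * gaussTail 0 (r * Real.sin θ)) =
      (Set.Ioo 0 (Real.pi / 2)).indicator
        (fun θ => Real.exp (-x ^ 2 / (2 * Real.cos θ ^ 2))) θ := by
  by_cases h : θ ∈ Set.Ioo 0 (Real.pi / 2)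
  · rw [Set.indicator_of_mem h]
    have hsin : 0 < Real.sin θ := Real.sin_pos_of_pos_of_lt_pi h.1 hθ.2
    have hcos : 0 < Real.cos θ := Real.cos_pos_of_mem_Ioo ⟨by linarith [h.1, Real.pi_pos], h.2⟩
    have ha : 0 ≤ x / Real.cos θ := div_nonneg hx hcos.le
    have hval := (integrableOn_mul_exp_neg_sq_and_integral_eq ha).2
    rw [show -x ^ 2 / (2 * Real.cos θ ^ 2) = -(x / Real.cos θ) ^ 2 / 2 by field_simp, ← hval]
    rw [← integral_indicator measurableSet_Ioi, ← integral_indicator measurableSet_Ioi]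
    congr 1 with r
    by_cases hr : x / Real.cos θ < r
    · have hr0 : 0 < r := ha.trans_lt hr
      rw [Set.indicator_of_mem (Set.mem_Ioi.2 hr0), Set.indicator_of_mem (Set.mem_Ioi.2 hr),
        gaussTail_of_lt ((div_lt_iff₀ hcos).1 hr), gaussTail_of_lt (mul_pos hr0 hsin),
        exp_neg_sq_mul_cos_mul_exp_neg_sq_mul_sin]
    · rw [Set.indicator_of_notMem (s := Set.Ioi (x / Real.cos θ)) (by simpa using hr)]
      refine Set.indicator_apply_eq_zero.2 fun _ => ?_
      rw [gaussTail_of_le ((le_div_iff₀ hcos).1 (not_lt.1 hr))]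
      ring
  · rw [Set.indicator_of_notMem h]
    refine setIntegral_eq_zero_of_forall_eq_zero fun r hr => ?_
    have hr : 0 < r := hr
    rcases le_or_gt θ 0 with h0 | h0
    · rw [gaussTail_of_le (a := 0) (mul_nonpos_of_nonneg_of_nonpos hr.le
        (Real.sin_nonpos_of_nonpos_of_neg_pi_le h0 hθ.1.le))]
      ring
    · have h2 : Real.pi / 2 ≤ θ := not_lt.1 fun h2 => h ⟨h0, h2⟩
      rw [gaussTail_of_le ((mul_nonpos_of_nonneg_of_nonpos hr.le
        (Real.cos_nonpos_of_pi_div_two_le_of_le h2 (by linarith [hθ.2, Real.pi_pos]))).trans hx)]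
      ring

lemma integrableOn_polar_gaussTail (x : ℝ) :
    IntegrableOn (fun p : ℝ × ℝ => p.1 * (gaussTail x (p.1 * Real.cos p.2) *
      gaussTail 0 (p.1 * Real.sin p.2))) (Set.Ioi 0 ×ˢ Set.Ioo (-Real.pi) Real.pi)
      (volume.prod volume) := by
  have hdom : IntegrableOn (fun p : ℝ × ℝ => p.1 * Real.exp (-p.1 ^ 2 / 2) * 1)
      (Set.Ioi 0 ×ˢ Set.Ioo (-Real.pi) Real.pi) (volume.prod volume) := by
    rw [IntegrableOn, ← Measure.prod_restrict]
    exact Integrable.mul_prod (integrableOn_mul_exp_neg_sq_and_integral_eq le_rfl).1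
      (integrable_const (1 : ℝ))
  refine Integrable.mono' hdom ?_ ?_
  · have h1 := measurable_gaussTail x
    have h2 := measurable_gaussTail 0
    exact Measurable.aestronglyMeasurable (by fun_prop)
  · filter_upwards [ae_restrict_mem (measurableSet_Ioi.prod measurableSet_Ioo)] with p hp
    have hp : 0 < p.1 := hp.1
    rw [Real.norm_of_nonneg (mul_nonneg hp.le
      (mul_nonneg (gaussTail_nonneg _ _) (gaussTail_nonneg _ _))), mul_one,
      ← exp_neg_sq_mul_cos_mul_exp_neg_sq_mul_sin p.1 p.2]
    gcongr
    · exact gaussTail_nonneg _ _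
    · exact gaussTail_le _ _
    · exact gaussTail_le _ _

lemma integral_gaussTail_mul_integral_gaussTail_zero {x : ℝ} (hx : 0 ≤ x) :
    (∫ t, gaussTail x t) * ∫ t, gaussTail 0 t =
      ∫ θ in (0 : ℝ)..(Real.pi / 2), Real.exp (-x ^ 2 / (2 * Real.sin θ ^ 2)) := by
  calc (∫ t, gaussTail x t) * ∫ t, gaussTail 0 t
      = ∫ p : ℝ × ℝ, gaussTail x p.1 * gaussTail 0 p.2 := (integral_prod_mul _ _).symm
    _ = ∫ p in Set.Ioi (0 : ℝ) ×ˢ Set.Ioo (-Real.pi) Real.pi, p.1 *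
          (gaussTail x (p.1 * Real.cos p.2) * gaussTail 0 (p.1 * Real.sin p.2)) :=
        (integral_comp_polarCoord_symm fun p : ℝ × ℝ => gaussTail x p.1 * gaussTail 0 p.2).symm
    _ = ∫ θ in Set.Ioo (-Real.pi) Real.pi, ∫ r in Set.Ioi (0 : ℝ), r *
          (gaussTail x (r * Real.cos θ) * gaussTail 0 (r * Real.sin θ)) := by
        have h := integrableOn_polar_gaussTail x
        rw [IntegrableOn, ← Measure.prod_restrict] at h
        rw [Measure.volume_eq_prod, ← Measure.prod_restrict, integral_prod_symm _ h]
    _ = ∫ θ in Set.Ioo (-Real.pi) Real.pi, (Set.Ioo 0 (Real.pi / 2)).indicator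
          (fun θ => Real.exp (-x ^ 2 / (2 * Real.cos θ ^ 2))) θ :=
        setIntegral_congr_fun measurableSet_Ioo fun _ hθ => integral_radial_gaussTail hx hθ
    _ = ∫ θ in (0 : ℝ)..(Real.pi / 2), Real.exp (-x ^ 2 / (2 * Real.cos θ ^ 2)) := by
        have hpi := Real.pi_pos
        rw [setIntegral_indicator measurableSet_Ioo, Set.inter_eq_right.2
          (Set.Ioo_subset_Ioo (by linarith) (by linarith)),
          intervalIntegral.integral_of_le (by linarith), integral_Ioc_eq_integral_Ioo]
    _ = ∫ θ in (0 : ℝ)..(Real.pi / 2), Real.exp (-x ^ 2 / (2 * Real.sin θ ^ 2)) := by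
        have h := intervalIntegral.integral_comp_sub_left (a := 0) (b := Real.pi / 2)
          (fun θ => Real.exp (-x ^ 2 / (2 * Real.sin θ ^ 2))) (Real.pi / 2)
        simpa only [Real.sin_pi_div_two_sub, sub_self, sub_zero] using h

/-- Craig's representation of the Gaussian tail function:
for x ≥ 0, Q(x) = (1/π) ∫_0^{π/2} exp(−x²/(2 sin²θ)) dθ. -/
theorem craig_formula (x : ℝ) (hx : 0 ≤ x) :
    gaussQ x =
      (1 / Real.pi) *
        ∫ θ in (0 : ℝ)..(Real.pi / 2), Real.exp (-x ^ 2 / (2 * Real.sin θ ^ 2)) := by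
  rw [← integral_gaussTail_mul_integral_gaussTail_zero hx, integral_gaussTail_zero, gaussQ,
    integral_const_mul, ← integral_gaussTail]
  have hpos : 0 < Real.sqrt (2 * Real.pi) := Real.sqrt_pos.2 (by positivity)
  have hsq : Real.sqrt (2 * Real.pi) ^ 2 = 2 * Real.pi := Real.sq_sqrt (by positivity)
  field_simp
  rw [hsq]
end

section
/- Let m be a positive natural number and γ > 0 a real number, and let Q(x) = ∫_x^∞ (1/√(2π)) e^{−t²/2} dt. Then (1/(m−1)!) ∫_0^∞ Q(√(2γα)) · α^{m−1} e^{−α} dα = (1/π) ∫_0^{π/2} (1 + γ/sin²θ)^{−m} dθ. -/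
open MeasureTheory

/-- The two-dimensional Gaussian weight of the half-plane `{(u, v) | x < v}`. -/
theorem integral_gaussian_halfPlane (x : ℝ) :
    ∫ p : ℝ × ℝ, Real.exp (-p.1 ^ 2 / 2) *
        (Set.Ioi x).indicator (fun v ↦ Real.exp (-v ^ 2 / 2)) p.2 =
      2 * Real.pi * gaussQ x := by
  have h1 : ∫ u : ℝ, Real.exp (-u ^ 2 / 2) = Real.sqrt (2 * Real.pi) := by
    convert integral_gaussian (1 / 2) using 3
    · ring_nf
    · field_simp
  have h2 : ∫ v in Set.Ioi x, Real.exp (-v ^ 2 / 2) = Real.sqrt (2 * Real.pi) * gaussQ x := by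
    rw [gaussQ, integral_const_mul, ← mul_assoc, mul_one_div_cancel (by positivity), one_mul]
  rw [Measure.volume_eq_prod, integral_prod_mul (fun u : ℝ ↦ Real.exp (-u ^ 2 / 2)), h1,
    integral_indicator measurableSet_Ioi, h2, ← mul_assoc, Real.mul_self_sqrt (by positivity)]

theorem hasDerivAt_neg_exp_neg_sq_div_two (r : ℝ) :
    HasDerivAt (fun r : ℝ ↦ -Real.exp (-r ^ 2 / 2)) (r * Real.exp (-r ^ 2 / 2)) r := by
  refine (((hasDerivAt_pow 2 r).fun_neg.div_const 2).exp).fun_neg.congr_deriv ?_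
  push_cast
  ring

theorem tendsto_neg_exp_neg_sq_div_two :
    Filter.Tendsto (fun r : ℝ ↦ -Real.exp (-r ^ 2 / 2)) Filter.atTop (nhds 0) := by
  have h : Filter.Tendsto (fun r : ℝ ↦ r ^ 2 / 2) Filter.atTop Filter.atTop :=
    (Filter.tendsto_pow_atTop two_ne_zero).atTop_div_const two_pos
  have := (Real.tendsto_exp_neg_atTop_nhds_zero.comp h).neg
  simpa [Function.comp_def, neg_div] using this

theorem integral_Ioi_mul_exp_neg_sq_div_two {a : ℝ} (ha : 0 ≤ a) :
    ∫ r in Set.Ioi a, r * Real.exp (-r ^ 2 / 2) = Real.exp (-a ^ 2 / 2) := by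
  rw [integral_Ioi_of_hasDerivAt_of_nonneg' (fun r _ ↦ hasDerivAt_neg_exp_neg_sq_div_two r)
    (fun r hr ↦ mul_nonneg (ha.trans (Set.mem_Ioi.1 hr).le) (Real.exp_pos _).le)
    tendsto_neg_exp_neg_sq_div_two]
  simp

theorem integrableOn_Ioi_mul_exp_neg_sq_div_two :
    IntegrableOn (fun r : ℝ ↦ r * Real.exp (-r ^ 2 / 2)) (Set.Ioi 0) :=
  integrableOn_Ioi_deriv_of_nonneg' (fun r _ ↦ hasDerivAt_neg_exp_neg_sq_div_two r)
    (fun _ hr ↦ mul_nonneg (Set.mem_Ioi.1 hr).le (Real.exp_pos _).le)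
    tendsto_neg_exp_neg_sq_div_two

/-- The radial integral of the Gaussian weight of a half-plane along the ray at angle `θ`. -/
theorem integral_radial_halfPlane {x : ℝ} (hx : 0 < x) (θ : ℝ) :
    ∫ r in Set.Ioi (0 : ℝ), r * (Real.exp (-(r * Real.cos θ) ^ 2 / 2) *
        (Set.Ioi x).indicator (fun v ↦ Real.exp (-v ^ 2 / 2)) (r * Real.sin θ)) =
      if 0 < Real.sin θ then Real.exp (-x ^ 2 / (2 * Real.sin θ ^ 2)) else 0 := by
  split_ifs with hs
  · have hpos : 0 < x / Real.sin θ := by positivity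
    calc
      _ = ∫ r in Set.Ioi (0 : ℝ), (Set.Ioi (x / Real.sin θ)).indicator
            (fun r ↦ r * Real.exp (-r ^ 2 / 2)) r := by
        congr 1 with r
        by_cases hr : x < r * Real.sin θ
        · rw [Set.indicator_of_mem (Set.mem_Ioi.2 hr),
            Set.indicator_of_mem (Set.mem_Ioi.2 ((div_lt_iff₀ hs).2 hr)), ← Real.exp_add]
          congr 2
          linear_combination (-r ^ 2 / 2) * Real.sin_sq_add_cos_sq θ
        · rw [Set.indicator_of_notMem (by simpa using hr),
            Set.indicator_of_notMem (by simpa [div_lt_iff₀ hs] using hr)]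
          simp
      _ = ∫ r in Set.Ioi (x / Real.sin θ), r * Real.exp (-r ^ 2 / 2) := by
        rw [setIntegral_indicator measurableSet_Ioi, Set.Ioi_inter_Ioi, sup_of_le_right hpos.le]
      _ = _ := by
        rw [integral_Ioi_mul_exp_neg_sq_div_two hpos.le]
        congr 1
        field_simp
  · refine setIntegral_eq_zero_of_forall_eq_zero fun r hr ↦ ?_
    rw [Set.indicator_of_notMem, mul_zero, mul_zero]
    have : r * Real.sin θ ≤ 0 := mul_nonpos_of_nonneg_of_nonpos (Set.mem_Ioi.1 hr).le (not_lt.1 hs)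
    simpa using this.trans hx.le

/-- An integral over `(0, π)` of a function of `sin θ` is twice the integral over `(0, π / 2)`. -/
theorem integral_comp_sin_zero_pi {f : ℝ → ℝ}
    (hf : IntervalIntegrable (fun θ ↦ f (Real.sin θ)) volume 0 Real.pi) :
    ∫ θ in (0 : ℝ)..Real.pi, f (Real.sin θ) =
      2 * ∫ θ in (0 : ℝ)..(Real.pi / 2), f (Real.sin θ) := by
  have hmem : Real.pi / 2 ∈ Set.uIcc 0 Real.pi := by
    rw [Set.uIcc_of_le Real.pi_pos.le]
    constructor <;> linarith [Real.pi_pos]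
  have hsym : ∫ θ in (Real.pi / 2)..Real.pi, f (Real.sin θ) =
      ∫ θ in (0 : ℝ)..(Real.pi / 2), f (Real.sin θ) := by
    have := intervalIntegral.integral_comp_sub_left (a := 0) (b := Real.pi / 2)
      (fun θ ↦ f (Real.sin θ)) Real.pi
    simp only [Real.sin_pi_sub, sub_zero, sub_half] at this
    exact this.symm
  rw [← intervalIntegral.integral_add_adjacent_intervals
    (hf.mono_set (Set.uIcc_subset_uIcc_left hmem))
    (hf.mono_set (Set.uIcc_subset_uIcc_right hmem)), hsym, two_mul]

/-- **Craig's formula** for the Gaussian tail function. -/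
theorem gaussQ_eq_craig {x : ℝ} (hx : 0 < x) :
    gaussQ x = (1 / Real.pi) *
      ∫ θ in (0 : ℝ)..(Real.pi / 2), Real.exp (-x ^ 2 / (2 * Real.sin θ ^ 2)) := by
  set F : ℝ × ℝ → ℝ := fun p ↦ Real.exp (-p.1 ^ 2 / 2) *
    (Set.Ioi x).indicator (fun v ↦ Real.exp (-v ^ 2 / 2)) p.2 with hF
  have hFm : Measurable F :=
    (by fun_prop : Measurable fun p : ℝ × ℝ ↦ Real.exp (-p.1 ^ 2 / 2)).mul
      (((by fun_prop : Measurable fun v : ℝ ↦ Real.exp (-v ^ 2 / 2)).indicator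
        measurableSet_Ioi).comp measurable_snd)
  have hFle (p : ℝ × ℝ) : ‖F p‖ ≤ Real.exp (-(p.1 ^ 2 + p.2 ^ 2) / 2) := by
    have : -(p.1 ^ 2 + p.2 ^ 2) / 2 = -p.1 ^ 2 / 2 + -p.2 ^ 2 / 2 := by ring
    rw [this, Real.exp_add, hF, norm_mul, Real.norm_of_nonneg (Real.exp_pos _).le]
    gcongr
    refine (norm_indicator_le_norm_self _ _).trans ?_
    rw [Real.norm_of_nonneg (Real.exp_pos _).le]
  have hint : Integrable
      (Function.uncurry fun r θ : ℝ ↦ r * F (r * Real.cos θ, r * Real.sin θ))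
      ((volume.restrict (Set.Ioi 0)).prod (volume.restrict (Set.Ioo (-Real.pi) Real.pi))) := by
    refine (Integrable.mul_prod (integrableOn_Ioi_mul_exp_neg_sq_div_two)
      (integrable_const (1 : ℝ))).mono' ?_ ?_
    · exact (measurable_fst.mul (hFm.comp (by fun_prop))).aestronglyMeasurable
    · rw [Measure.prod_restrict]
      refine (ae_restrict_mem (measurableSet_Ioi.prod measurableSet_Ioo)).mono ?_
      rintro ⟨r, θ⟩ ⟨hr, -⟩
      have hr : 0 < r := hr
      simp only [Function.uncurry, norm_mul, Real.norm_of_nonneg hr.le, mul_one]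
      gcongr
      refine (hFle _).trans (le_of_eq ?_)
      congr 2
      linear_combination (-r ^ 2) * Real.sin_sq_add_cos_sq θ
  have hpolar : 2 * Real.pi * gaussQ x = ∫ θ in Set.Ioo (-Real.pi) Real.pi,
      if 0 < Real.sin θ then Real.exp (-x ^ 2 / (2 * Real.sin θ ^ 2)) else 0 := by
    rw [← integral_gaussian_halfPlane, ← integral_comp_polarCoord_symm, polarCoord_target,
      Measure.volume_eq_prod, ← Measure.prod_restrict]
    simp_rw [← integral_radial_halfPlane hx]
    exact (integral_integral hint).symm.trans (integral_integral_swap hint)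
  have hhalf : ∫ θ in Set.Ioo (-Real.pi) Real.pi,
        (if 0 < Real.sin θ then Real.exp (-x ^ 2 / (2 * Real.sin θ ^ 2)) else 0) =
      ∫ θ in (0 : ℝ)..Real.pi, Real.exp (-x ^ 2 / (2 * Real.sin θ ^ 2)) := by
    rw [intervalIntegral.integral_of_le Real.pi_pos.le, integral_Ioc_eq_integral_Ioo,
      setIntegral_eq_of_subset_of_forall_sdiff_eq_zero measurableSet_Ioo
        (Set.Ioo_subset_Ioo_left (by linarith [Real.pi_pos] : -Real.pi ≤ 0))]
    · refine setIntegral_congr_fun measurableSet_Ioo fun θ hθ ↦ ?_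
      exact if_pos (Real.sin_pos_of_mem_Ioo hθ)
    · rintro θ ⟨⟨h1, h2⟩, h3⟩
      refine if_neg (not_lt.2 (Real.sin_nonpos_of_nonpos_of_neg_pi_le ?_ h1.le))
      by_contra! h
      exact h3 ⟨h, h2⟩
  have hii : IntervalIntegrable (fun θ ↦ Real.exp (-x ^ 2 / (2 * Real.sin θ ^ 2)))
      volume 0 Real.pi := by
    refine (intervalIntegrable_const (c := (1 : ℝ))).mono_fun
      (by fun_prop : Measurable _).aestronglyMeasurable (ae_of_all _ fun θ ↦ ?_)
    simp only [Real.norm_of_nonneg (Real.exp_pos _).le, norm_one, Real.exp_le_one_iff]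
    exact div_nonpos_of_nonpos_of_nonneg (by nlinarith) (by positivity)
  rw [hhalf, integral_comp_sin_zero_pi (f := fun s ↦ Real.exp (-x ^ 2 / (2 * s ^ 2))) hii] at hpolar
  rw [one_div, eq_inv_mul_iff_mul_eq₀ Real.pi_ne_zero]
  linarith

/-- The Laplace transform of `α ^ (m - 1)`, evaluated at `1 + c`. -/
theorem integral_exp_neg_mul_pow_mul_exp_neg {m : ℕ} (hm : 0 < m) {c : ℝ} (hc : 0 ≤ c) :
    ∫ α in Set.Ioi (0 : ℝ), Real.exp (-(c * α)) * α ^ (m - 1) * Real.exp (-α) =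
      (Nat.factorial (m - 1) : ℝ) * (1 + c) ^ (-(m : ℝ)) := by
  have hpos : 0 < 1 + c := by positivity
  have hG : Real.Gamma m = (Nat.factorial (m - 1) : ℝ) := by
    obtain ⟨k, rfl⟩ := Nat.exists_eq_add_of_lt hm
    simpa using Real.Gamma_nat_eq_factorial k
  rw [Real.rpow_neg hpos.le, ← Real.inv_rpow hpos.le, ← one_div, mul_comm, ← hG,
    ← Real.integral_rpow_mul_exp_neg_mul_Ioi (Nat.cast_pos.2 hm) hpos]
  refine integral_congr_ae (ae_of_all _ fun α ↦ ?_)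
  have : ((m : ℝ) - 1) = ((m - 1 : ℕ) : ℝ) := by push_cast [Nat.cast_sub hm]; ring
  simp only [this, Real.rpow_natCast]
  rw [show -((1 + c) * α) = -(c * α) + -α by ring, Real.exp_add]
  ring

/-- The Gamma(m,1)-average of Q(√(2γα)) equals the single
finite-range (Craig-type) integral (1/π) ∫_0^{π/2} (1 + γ/sin²θ)^{−m} dθ. -/
theorem avg_pep_craig_form (m : ℕ) (hm : 0 < m) (γ : ℝ) (hγ : 0 < γ) :
    (1 / (Nat.factorial (m - 1) : ℝ)) *
        ∫ α in Set.Ioi (0 : ℝ),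
          gaussQ (Real.sqrt (2 * γ * α)) * α ^ (m - 1) * Real.exp (-α) =
      (1 / Real.pi) *
        ∫ θ in (0 : ℝ)..(Real.pi / 2), (1 + γ / Real.sin θ ^ 2) ^ (-(m : ℝ)) := by
  have hΓ : IntegrableOn (fun α : ℝ ↦ α ^ (m - 1) * Real.exp (-α)) (Set.Ioi 0) := by
    refine (Real.GammaIntegral_convergent (Nat.cast_pos.2 hm)).congr_fun (fun α _ ↦ ?_)
      measurableSet_Ioi
    have : ((m : ℝ) - 1) = ((m - 1 : ℕ) : ℝ) := by push_cast [Nat.cast_sub hm]; ring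
    simp only [this, Real.rpow_natCast]
    ring
  have hint : Integrable (Function.uncurry fun θ α : ℝ ↦
        Real.exp (-(γ / Real.sin θ ^ 2 * α)) * α ^ (m - 1) * Real.exp (-α))
      ((volume.restrict (Set.uIoc 0 (Real.pi / 2))).prod (volume.restrict (Set.Ioi 0))) := by
    have : IsFiniteMeasure (volume.restrict (Set.uIoc 0 (Real.pi / 2))) :=
      ⟨by simp [Set.uIoc]⟩
    refine (Integrable.mul_prod (integrable_const (1 : ℝ)) hΓ).mono'
      (by fun_prop : Measurable _).aestronglyMeasurable ?_
    rw [Measure.prod_restrict]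
    refine (ae_restrict_mem (measurableSet_uIoc.prod measurableSet_Ioi)).mono ?_
    rintro ⟨θ, α⟩ ⟨-, hα⟩
    have hα : 0 < α := hα
    rw [Function.uncurry, Real.norm_of_nonneg (by positivity), mul_assoc]
    gcongr
    rw [Real.exp_le_one_iff, neg_nonpos]
    positivity
  have hcraig : ∫ α in Set.Ioi (0 : ℝ),
        gaussQ (Real.sqrt (2 * γ * α)) * α ^ (m - 1) * Real.exp (-α) =
      ∫ α in Set.Ioi (0 : ℝ), (1 / Real.pi) * ∫ θ in (0 : ℝ)..(Real.pi / 2),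
        Real.exp (-(γ / Real.sin θ ^ 2 * α)) * α ^ (m - 1) * Real.exp (-α) := by
    refine setIntegral_congr_fun measurableSet_Ioi fun α hα ↦ ?_
    have hα : 0 < α := hα
    have hexp (θ : ℝ) : -(2 * γ * α) / (2 * Real.sin θ ^ 2) = -(γ / Real.sin θ ^ 2 * α) := by
      rw [show -(2 * γ * α) = 2 * -(γ * α) by ring, mul_div_mul_left _ _ two_ne_zero]
      ring
    simp only [gaussQ_eq_craig (Real.sqrt_pos.2 (by positivity : 0 < 2 * γ * α)),
      Real.sq_sqrt (by positivity : 0 ≤ 2 * γ * α), hexp, intervalIntegral.integral_mul_const]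
    ring
  rw [hcraig, integral_const_mul, ← intervalIntegral_integral_swap hint]
  simp_rw [fun θ ↦ integral_exp_neg_mul_pow_mul_exp_neg hm
    (by positivity : 0 ≤ γ / Real.sin θ ^ 2), intervalIntegral.integral_const_mul]
  have := Nat.cast_ne_zero (R := ℝ).2 (m - 1).factorial_ne_zero
  field_simp
end
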